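/- Assume: β̂, β̂_Γ : ℝ → [0,+∞] are convex, proper, lower semicontinuous with β̂(0) = β̂_Γ(0) = 0; β := ∂β̂ and β_Γ := ∂β̂_Γ are their subdifferentials; D(β) ⊇ D(β_Γ); η > 0 and C_Γ ≥ 0 are constants such that |β°(r)| ≤ η|β_Γ°(r)| + C_Γ for every r ∈ D(β_Γ). Then for every ε > 0 and every s > 0 the Yosida approximations satisfy β^Y_ε(s + εC_Γ) ≤ η·(β_Γ)^Y_{εη}(s) + C_Γ. -/

import Mathlib

/-- Convexity for an `EReal`-valued function on ℝ. -/
def ERealConvexOn (φ : ℝ → EReal) : Prop :=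
  ∀ x y : ℝ, ∀ t : ℝ, 0 ≤ t → t ≤ 1 →
    φ (t * x + (1 - t) * y) ≤ (t : EReal) * φ x + ((1 - t : ℝ) : EReal) * φ y

/-- The subdifferential graph `∂φ ⊆ ℝ × ℝ` of `φ : ℝ → [0,+∞]`. -/
def subdiff (φ : ℝ → EReal) : Set (ℝ × ℝ) :=
  {p | φ p.1 ≠ ⊤ ∧ ∀ w : ℝ, φ p.1 + ((p.2 * (w - p.1) : ℝ) : EReal) ≤ φ w}

/-- The minimal section `γ°(r)`: the element of `γ(r)` of minimum absolute value. -/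
noncomputable def minSection (γ : Set (ℝ × ℝ)) (r : ℝ) : ℝ :=
  Classical.epsilon fun s => (r, s) ∈ γ ∧ ∀ t : ℝ, (r, t) ∈ γ → |s| ≤ |t|

/-- The resolvent value `(I + εγ)⁻¹(r)`: the (unique, by maximal monotonicity)
`y` with `(y, (r − y)/ε) ∈ γ`. -/
noncomputable def resolventPt (γ : Set (ℝ × ℝ)) (ε r : ℝ) : ℝ :=
  Classical.epsilon fun y => (y, (r - y) / ε) ∈ γ

/-- The Yosida approximation `γ^Y_ε(r) = (r − (I + εγ)⁻¹ r)/ε`. -/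
noncomputable def yosida (γ : Set (ℝ × ℝ)) (ε r : ℝ) : ℝ :=
  (r - resolventPt γ ε r) / ε

theorem subdiff_monotone {φ : ℝ → EReal} (hnn : ∀ r, 0 ≤ φ r) {x y s t : ℝ}
    (hs : (x, s) ∈ subdiff φ) (ht : (y, t) ∈ subdiff φ) : 0 ≤ (s - t) * (x - y) := by
  obtain ⟨hx, hs⟩ := hs
  obtain ⟨hy, ht⟩ := ht
  have h1 := hs y
  have h2 := ht x
  simp only at hx hy h1 h2
  lift φ x to ℝ using ⟨hx, ne_bot_of_le_ne_bot (by simp) (hnn x)⟩ with a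
  lift φ y to ℝ using ⟨hy, ne_bot_of_le_ne_bot (by simp) (hnn y)⟩ with b
  norm_cast at h1 h2
  nlinarith

theorem zero_mem_subdiff {φ : ℝ → EReal} (hnn : ∀ r, 0 ≤ φ r) (h0 : φ 0 = 0) :
    ((0 : ℝ), (0 : ℝ)) ∈ subdiff φ := by
  refine ⟨by simp [h0], fun w => ?_⟩
  simpa [h0] using hnn w

theorem isClosed_subdiff_section {φ : ℝ → EReal} (hnn : ∀ r, 0 ≤ φ r) (r : ℝ) :
    IsClosed {s | (r, s) ∈ subdiff φ} := by
  by_cases hr : φ r = ⊤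
  · simp [subdiff, hr]
  have : {s | (r, s) ∈ subdiff φ} =
      ⋂ w, {s : ℝ | φ r + ((s * (w - r) : ℝ) : EReal) ≤ φ w} := by
    ext s; simp [subdiff, hr]
  rw [this]
  refine isClosed_iInter fun w => ?_
  lift φ r to ℝ using ⟨hr, ne_bot_of_le_ne_bot (by simp) (hnn r)⟩ with a
  norm_cast
  exact isClosed_le (continuous_coe_real_ereal.comp (by fun_prop)) continuous_const

theorem minSection_spec {φ : ℝ → EReal} (hnn : ∀ r, 0 ≤ φ r) {r : ℝ}
    (hr : ∃ t, (r, t) ∈ subdiff φ) :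
    (r, minSection (subdiff φ) r) ∈ subdiff φ ∧
      ∀ t, (r, t) ∈ subdiff φ → |minSection (subdiff φ) r| ≤ |t| := by
  obtain ⟨s, hs, hmin⟩ :=
    (isClosed_subdiff_section hnn r).exists_infDist_eq_dist hr (0 : ℝ)
  refine Classical.epsilon_spec
    (p := fun s => (r, s) ∈ subdiff φ ∧ ∀ t : ℝ, (r, t) ∈ subdiff φ → |s| ≤ |t|)
    ⟨s, hs, fun t ht => ?_⟩
  have h := Metric.infDist_le_dist_of_mem (x := (0 : ℝ)) (s := {s | (r, s) ∈ subdiff φ}) ht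
  rw [hmin] at h
  simpa [Real.dist_eq] using h

theorem exists_isMin_add_sq {φ : ℝ → EReal} (hnn : ∀ r, 0 ≤ φ r)
    (hlsc : LowerSemicontinuous φ) (h0 : φ 0 = 0) {ε : ℝ} (hε : 0 < ε) (r : ℝ) :
    ∃ y, ∀ w, φ y + (((y - r) ^ 2 / (2 * ε) : ℝ) : EReal) ≤
      φ w + (((w - r) ^ 2 / (2 * ε) : ℝ) : EReal) := by
  have hf : LowerSemicontinuous
      fun y => φ y + (((y - r) ^ 2 / (2 * ε) : ℝ) : EReal) := by
    refine hlsc.add' (continuous_coe_real_ereal.comp (by fun_prop)).lowerSemicontinuous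
      fun x => EReal.continuousAt_add (by simp) (by simp)
  have hmem : (0 : ℝ) ∈ Metric.closedBall r |r| := by simp
  obtain ⟨y, -, hy⟩ := (hf.lowerSemicontinuousOn _).exists_isMinOn ⟨0, hmem⟩
    (isCompact_closedBall r |r|)
  refine ⟨y, fun w => ?_⟩
  by_cases hw : w ∈ Metric.closedBall r |r|
  · exact hy hw
  · refine (hy hmem).trans ?_
    have hsq : (0 - r) ^ 2 / (2 * ε) ≤ (w - r) ^ 2 / (2 * ε) := by
      rw [Metric.mem_closedBall, Real.dist_eq, not_le] at hw
      refine div_le_div_of_nonneg_right (sq_le_sq.mpr ?_) (by positivity)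
      simpa using hw.le
    simp only [h0]
    exact add_le_add (hnn w) (by exact_mod_cast hsq)

theorem resolventPt_spec {φ : ℝ → EReal} (hnn : ∀ r, 0 ≤ φ r) (hconv : ERealConvexOn φ)
    (hlsc : LowerSemicontinuous φ) (h0 : φ 0 = 0) {ε : ℝ} (hε : 0 < ε) (r : ℝ) :
    (resolventPt (subdiff φ) ε r, (r - resolventPt (subdiff φ) ε r) / ε) ∈ subdiff φ := by
  refine Classical.epsilon_spec (p := fun y => (y, (r - y) / ε) ∈ subdiff φ) ?_
  obtain ⟨y, hy⟩ := exists_isMin_add_sq hnn hlsc h0 hε r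
  have hyt : φ y ≠ ⊤ := by
    intro h
    have := hy 0
    rw [h, h0, EReal.top_add_coe, zero_add] at this
    exact EReal.coe_ne_top _ (top_le_iff.mp this)
  refine ⟨y, hyt, fun w => ?_⟩
  by_cases hwt : φ w = ⊤
  · simp [hwt]
  simp only
  obtain ⟨a, ha⟩ : ∃ a : ℝ, (a : EReal) = φ y :=
    ⟨_, EReal.coe_toReal hyt (ne_bot_of_le_ne_bot (by simp) (hnn y))⟩
  obtain ⟨b, hb⟩ : ∃ b : ℝ, (b : EReal) = φ w :=
    ⟨_, EReal.coe_toReal hwt (ne_bot_of_le_ne_bot (by simp) (hnn w))⟩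
  have key : ∀ t : ℝ, 0 < t → t ≤ 1 →
      a + (r - y) / ε * (w - y) ≤ b + t * ((w - y) ^ 2 / (2 * ε)) := by
    intro t ht ht1
    have h := (hy (t * w + (1 - t) * y)).trans
      (add_le_add_left (hconv w y t ht.le ht1) _)
    rw [← ha, ← hb] at h
    norm_cast at h
    have e : (t * w + (1 - t) * y - r) ^ 2 / (2 * ε) = (y - r) ^ 2 / (2 * ε)
        - t * ((r - y) / ε * (w - y)) + t * (t * ((w - y) ^ 2 / (2 * ε))) := by
      field_simp
      ring
    rw [e] at h
    refine le_of_mul_le_mul_left ?_ ht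
    linarith
  rw [← ha, ← hb]
  norm_cast
  have hlim : Filter.Tendsto (fun t : ℝ => b + t * ((w - y) ^ 2 / (2 * ε)))
      (nhdsWithin 0 (Set.Ioi 0)) (nhds b) := by
    have hc : Continuous fun t : ℝ => b + t * ((w - y) ^ 2 / (2 * ε)) := by fun_prop
    simpa using (hc.tendsto 0).mono_left nhdsWithin_le_nhds
  refine ge_of_tendsto hlim ?_
  filter_upwards [Ioc_mem_nhdsGT (zero_lt_one' ℝ)] with t ht
  exact key t ht.1 ht.2

/-- Under the compatibility assumptions `D(β) ⊇ D(β_Γ)` and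
`|β°(r)| ≤ η|β_Γ°(r)| + C_Γ` on `D(β_Γ)`, for every `ε > 0` and `s > 0` the
Yosida approximations satisfy `β^Y_ε(s + εC_Γ) ≤ η·(β_Γ)^Y_{εη}(s) + C_Γ`. -/
theorem yosida_compare (betaHat betaGammaHat : ℝ → EReal)
    (hnn : ∀ r : ℝ, 0 ≤ betaHat r) (hnnΓ : ∀ r : ℝ, 0 ≤ betaGammaHat r)
    (hconv : ERealConvexOn betaHat) (hconvΓ : ERealConvexOn betaGammaHat)
    (hlsc : LowerSemicontinuous betaHat) (hlscΓ : LowerSemicontinuous betaGammaHat)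
    (hzero : betaHat 0 = 0) (hzeroΓ : betaGammaHat 0 = 0)
    (η CΓ : ℝ) (hη : 0 < η) (hCΓ : 0 ≤ CΓ)
    (hdom : ∀ r : ℝ, (∃ t : ℝ, (r, t) ∈ subdiff betaGammaHat) →
      ∃ t : ℝ, (r, t) ∈ subdiff betaHat)
    (hcomp : ∀ r : ℝ, (∃ t : ℝ, (r, t) ∈ subdiff betaGammaHat) →
      |minSection (subdiff betaHat) r| ≤ η * |minSection (subdiff betaGammaHat) r| + CΓ) :
    ∀ ε : ℝ, 0 < ε → ∀ s : ℝ, 0 < s →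
      yosida (subdiff betaHat) ε (s + ε * CΓ) ≤
        η * yosida (subdiff betaGammaHat) (ε * η) s + CΓ := by
  intro ε hε s hs
  have hx := resolventPt_spec hnn hconv hlsc hzero hε (s + ε * CΓ)
  have hy := resolventPt_spec hnnΓ hconvΓ hlscΓ hzeroΓ (mul_pos hε hη) s
  unfold yosida
  set x := resolventPt (subdiff betaHat) ε (s + ε * CΓ)
  set y := resolventPt (subdiff betaGammaHat) (ε * η) s
  have hrhs : η * ((s - y) / (ε * η)) + CΓ = (s + ε * CΓ - y) / ε := by
    field_simp
    ring
  by_contra! hlt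
  have hxy : x < y := by
    rw [hrhs, div_lt_div_iff_of_pos_right hε] at hlt
    linarith
  have hσ : 0 ≤ (s - y) / (ε * η) := by
    by_contra! hneg
    have hmon := subdiff_monotone hnnΓ hy (zero_mem_subdiff hnnΓ hzeroΓ)
    have hsy : s < y := by
      have := (div_lt_iff₀ (mul_pos hε hη)).mp hneg
      linarith
    nlinarith
  have hΓ : ∃ t, (y, t) ∈ subdiff betaGammaHat := ⟨_, hy⟩
  have hminΓ := (minSection_spec hnnΓ hΓ).2 _ hy
  rw [abs_of_nonneg hσ] at hminΓ
  have hmin := (minSection_spec hnn (hdom y hΓ)).1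
  have hmon := subdiff_monotone hnn hmin hx
  have hge := nonneg_of_mul_nonneg_left hmon (sub_pos.mpr hxy)
  have := hcomp y hΓ
  have := le_abs_self (minSection (subdiff betaHat) y)
  have := mul_le_mul_of_nonneg_left hminΓ hη.le
  linarith
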